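/- arXiv:2103.00126 — 3 statements merged into one kernel-verified Lean document; each statement's English description precedes it below -/
import Mathlib

section
/- Let r ≥ 1, V ≥ 0 and d_f ≥ 2 be integers, let a > 0 and t ≥ 0 be real numbers, set M = 2^r·(V+1), and let θ_0, θ_1, …, θ_{d_f−1} be real numbers. Define the total energy E_c = ∑ over all tuples (v_0,…,v_{d_f−1}) ∈ {0,…,V}^{d_f} and (l_0,…,l_{d_f−1}) ∈ {0,…,2^r−1}^{d_f} of | ∑_{n=0}^{d_f−1} (a + v_n t) · e^{i(2πl_n/2^r + θ_n)} |². Then E_c = d_f · M^{d_f−1} · 2^r · ( ∑_{v=0}^{V} (a+vt)² ) + 2·M^{d_f−2} · ( ∑_{q=1}^{2^r} 2q·cos(2πq/2^r) − 2^r ) · ( ∑_{v=0}^{V} (a+vt) )² · ( ∑_{0 ≤ n < m ≤ d_f−1} cos(θ_n − θ_m) ). (Energy formula (16)/(C.9) for the superimposed constellation, Appendix C) -/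
open Finset

theorem sum_exp_two_pi_mul_div_eq_zero (N : ℕ) (hN : 2 ≤ N) :
    ∑ l ∈ range N, Complex.exp (Complex.I * ((2 * Real.pi * (l : ℝ) / N : ℝ) : ℂ)) = 0 := by
  have h := (Complex.isPrimitiveRoot_exp N (by omega)).geom_sum_eq_zero (by omega)
  rw [← h]
  refine sum_congr rfl fun l _ => ?_
  rw [← Complex.exp_nat_mul]
  congr 1
  push_cast
  ring

theorem sum_cos_two_pi_mul_div_eq_zero (N : ℕ) (hN : 2 ≤ N) :
    ∑ q ∈ range N, Real.cos (2 * Real.pi * (q : ℝ) / N) = 0 := by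
  have h := congrArg Complex.re (sum_exp_two_pi_mul_div_eq_zero N hN)
  rw [Complex.re_sum] at h
  simpa only [mul_comm Complex.I, Complex.exp_ofReal_mul_I_re, Complex.zero_re] using h

theorem sum_two_mul_mul_cos_two_pi_mul_div (N : ℕ) (hN : 2 ≤ N) :
    ∑ q ∈ Icc 1 N, 2 * (q : ℝ) * Real.cos (2 * Real.pi * (q : ℝ) / N) = N := by
  have hN0 : (N : ℝ) ≠ 0 := by positivity
  set c : ℕ → ℝ := fun q => Real.cos (2 * Real.pi * (q : ℝ) / N) with hc
  have hcN : c N = 1 := by simp [hc, hN0]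
  have hsymm : ∀ q ∈ range N, c (N - q) = c q := by
    intro q hq
    have hq' : q ≤ N := (mem_range.mp hq).le
    simp only [hc]
    rw [Nat.cast_sub hq', show 2 * Real.pi * ((N : ℝ) - q) / N
      = 2 * Real.pi - 2 * Real.pi * q / N by field_simp, Real.cos_two_pi_sub]
  have hIcc : ∑ q ∈ Icc 1 N, (q : ℝ) * c q = ∑ q ∈ range N, (q : ℝ) * c q + N := by
    have h := sum_range_succ (fun q : ℕ => (q : ℝ) * c q) N
    rw [hcN, mul_one] at h
    rw [← h, range_eq_Ico, sum_eq_sum_Ico_succ_bot (Nat.succ_pos N)]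
    simp only [Nat.cast_zero, zero_mul, zero_add]
    rfl
  have hreflect : ∑ q ∈ Icc 1 N, (q : ℝ) * c q = ∑ q ∈ range N, ((N : ℝ) - q) * c q := by
    symm
    refine sum_bij' (fun q _ => N - q) (fun q _ => N - q) ?_ ?_ ?_ ?_ ?_
    · intro q hq; simp at hq ⊢; omega
    · intro q hq; simp at hq ⊢; omega
    · intro q hq; simp at hq ⊢; omega
    · intro q hq; simp at hq ⊢; omega
    · intro q hq
      rw [hsymm q hq, Nat.cast_sub (mem_range.mp hq).le]
  have hzero : ∑ q ∈ range N, c q = 0 := sum_cos_two_pi_mul_div_eq_zero N hN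
  simp only [sub_mul, sum_sub_distrib, ← mul_sum, hzero] at hreflect
  change ∑ q ∈ Icc 1 N, 2 * (q : ℝ) * c q = N
  simp only [mul_assoc, ← mul_sum]
  linarith

theorem sum_pi_inner_eq_zero {ι κ E : Type*} [Fintype ι] [DecidableEq ι] [Fintype κ]
    [NormedAddCommGroup E] [InnerProductSpace ℝ E] (x y : κ → E) (hx : ∑ k, x k = 0)
    {i j : ι} (hij : j ≠ i) :
    ∑ g : ι → κ, inner ℝ (x (g i)) (y (g j)) = 0 := by
  rw [← (Equiv.funSplitAt i κ).symm.sum_comp, Fintype.sum_prod_type_right]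
  refine sum_eq_zero fun h _ => ?_
  simp [hij, ← sum_inner, hx]

/-- Superimposing centred finite families adds their energies. -/
theorem sum_pi_norm_sum_sq {ι κ E : Type*} [Fintype ι] [DecidableEq ι] [Fintype κ]
    [NormedAddCommGroup E] [InnerProductSpace ℝ E] (f : ι → κ → E)
    (hf : ∀ i, ∑ k, f i k = 0) :
    ∑ g : ι → κ, ‖∑ i, f i (g i)‖ ^ 2
      = (Fintype.card κ : ℝ) ^ (Fintype.card ι - 1) * ∑ i, ∑ k, ‖f i k‖ ^ 2 := by
  simp only [← real_inner_self_eq_norm_sq, sum_inner, inner_sum]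
  rw [sum_comm, mul_sum]
  refine sum_congr rfl fun i _ => ?_
  rw [sum_comm, sum_eq_single i]
  · simpa using Fintype.sum_piFinset_apply (fun k => inner ℝ (f i k) (f i k)) univ i
  · exact fun j _ hj => sum_pi_inner_eq_zero (f j) (f i) (hf j) hj.symm
  · simp


/-- **Energy formula (16)/(C.9), Appendix C.** The total energy `E_c` of the
superimposed constellation, i.e. the sum over all `M^{d_f}` superimposed points
(one point `(a + vₙt)·e^{i(2πlₙ/2^r + θₙ)}` from each of the `d_f` component
constellations) of their squared moduli. -/
theorem superimposed_energy_formula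
    (r V df : ℕ) (hr : 1 ≤ r) (hdf : 2 ≤ df)
    (a t : ℝ) (ha : 0 < a) (ht : 0 ≤ t)
    (M : ℕ) (hM : M = 2 ^ r * (V + 1))
    (θ : ℕ → ℝ)
    (Ec : ℝ)
    (hEc : Ec = ∑ v : Fin df → Fin (V + 1), ∑ l : Fin df → Fin (2 ^ r),
      norm (∑ n : Fin df,
        ((a + ((v n : ℕ) : ℝ) * t : ℝ) : ℂ) *
          Complex.exp (Complex.I *
            ((2 * Real.pi * ((l n : ℕ) : ℝ) / 2 ^ r + θ (n : ℕ) : ℝ) : ℂ))) ^ 2) :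
    Ec = (df : ℝ) * (M : ℝ) ^ (df - 1) * 2 ^ r *
          (∑ v ∈ Finset.range (V + 1), (a + (v : ℝ) * t) ^ 2)
      + 2 * (M : ℝ) ^ (df - 2) *
          ((∑ q ∈ Finset.Icc 1 (2 ^ r : ℕ),
              2 * (q : ℝ) * Real.cos (2 * Real.pi * (q : ℝ) / 2 ^ r)) - 2 ^ r) *
          (∑ v ∈ Finset.range (V + 1), (a + (v : ℝ) * t)) ^ 2 *
          (∑ p ∈ (Finset.range df ×ˢ Finset.range df).filter (fun p => p.1 < p.2),
            Real.cos (θ p.1 - θ p.2)) := by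
  have hN : 2 ≤ 2 ^ r := by simpa using Nat.pow_le_pow_right two_pos hr
  have hcos := sum_two_mul_mul_cos_two_pi_mul_div (2 ^ r) hN
  have hexp := sum_exp_two_pi_mul_div_eq_zero (2 ^ r) hN
  simp only [Nat.cast_pow, Nat.cast_ofNat] at hcos hexp
  rw [hcos, sub_self, mul_zero, zero_mul, zero_mul, add_zero, hEc]
  have hfibre (v : Fin df → Fin (V + 1)) :=
    sum_pi_norm_sum_sq (fun (n : Fin df) (l : Fin (2 ^ r)) =>
      ((a + ((v n : ℕ) : ℝ) * t : ℝ) : ℂ) * Complex.exp (Complex.I *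
        ((2 * Real.pi * ((l : ℕ) : ℝ) / 2 ^ r + θ (n : ℕ) : ℝ) : ℂ))) (fun n => by
      rw [← mul_sum, Fin.sum_univ_eq_sum_range (fun l : ℕ => Complex.exp (Complex.I *
        ((2 * Real.pi * (l : ℝ) / 2 ^ r + θ (n : ℕ) : ℝ) : ℂ)))]
      simp only [Complex.ofReal_add _ (θ n), mul_add, Complex.exp_add, ← sum_mul]
      rw [hexp, zero_mul, mul_zero])
  rw [sum_congr rfl fun v _ => hfibre v, ← mul_sum, sum_comm]
  have hamp (n : Fin df) :=
    Fintype.sum_piFinset_apply (fun v : Fin (V + 1) => (a + ((v : ℕ) : ℝ) * t) ^ 2) univ n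
  simp only [Fintype.piFinset_univ, card_univ, Fintype.card_fin, nsmul_eq_mul] at hamp
  simp only [norm_mul, mul_comm Complex.I, Complex.norm_exp_ofReal_mul_I, mul_one,
    Complex.norm_real, Real.norm_eq_abs, sq_abs, sum_const, card_univ, Fintype.card_fin,
    nsmul_eq_mul, ← mul_sum, hamp]
  rw [Fin.sum_univ_eq_sum_range (fun v : ℕ => (a + (v : ℝ) * t) ^ 2), hM]
  push_cast
  rw [mul_pow]
  ring
end

section
/- Let a > 0 and let φ_1, φ_2, δ be real numbers. Then | a·e^{i(φ_1+δ)} − a·e^{iφ_1} + a·e^{i(φ_2−δ)} − a·e^{iφ_2} |² = 8a² · sin²(δ/2) · ( 1 − cos(φ_1 − φ_2 + δ) ). In particular, with δ = 2π/2^r and φ_j = 2πl_j/2^r + θ_j this gives the squared distance 8a²·sin²(π/2^r)·(1 − cos(2π(l_1−l_2)/2^r + 2π/2^r + θ_1 − θ_2)) between two superimposed points that differ by opposite unit phase-index shifts in two of the component constellations. (Distance formula (17)/(D.8)–(D.9) of Appendix D) -/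
/-- The squared chord length between two points of the unit circle. -/
theorem norm_exp_I_mul_sub_exp_I_mul_sq (x y : ℝ) :
    ‖Complex.exp (Complex.I * (x : ℂ)) - Complex.exp (Complex.I * (y : ℂ))‖ ^ 2
      = 2 * (1 - Real.cos (x - y)) := by
  rw [← Complex.normSq_eq_norm_sq, mul_comm Complex.I, mul_comm Complex.I,
    Complex.normSq_apply, Complex.sub_re, Complex.sub_im, Complex.exp_ofReal_mul_I_re,
    Complex.exp_ofReal_mul_I_re, Complex.exp_ofReal_mul_I_im, Complex.exp_ofReal_mul_I_im,
    Real.cos_sub]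
  linear_combination Real.sin_sq_add_cos_sq x + Real.sin_sq_add_cos_sq y

/-- **Distance formula (17)/(D.8)–(D.9), Appendix D.** The squared Euclidean distance
between two superimposed points that differ by opposite phase shifts `±δ` in two of the
component constellations (common amplitude `a`):
`|a·e^{i(φ₁+δ)} - a·e^{iφ₁} + a·e^{i(φ₂-δ)} - a·e^{iφ₂}|²
  = 8a²·sin²(δ/2)·(1 - cos(φ₁ - φ₂ + δ))`. -/
theorem squared_distance_formula
    (a : ℝ) (ha : 0 < a) (φ1 φ2 δ : ℝ) :
    norm ((a : ℂ) * Complex.exp (Complex.I * ((φ1 + δ : ℝ) : ℂ))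
        - (a : ℂ) * Complex.exp (Complex.I * ((φ1 : ℝ) : ℂ))
        + (a : ℂ) * Complex.exp (Complex.I * ((φ2 - δ : ℝ) : ℂ))
        - (a : ℂ) * Complex.exp (Complex.I * ((φ2 : ℝ) : ℂ))) ^ 2
      = 8 * a ^ 2 * Real.sin (δ / 2) ^ 2 * (1 - Real.cos (φ1 - φ2 + δ)) := by
  have hfactor : (a : ℂ) * Complex.exp (Complex.I * ((φ1 + δ : ℝ) : ℂ))
        - (a : ℂ) * Complex.exp (Complex.I * ((φ1 : ℝ) : ℂ))
        + (a : ℂ) * Complex.exp (Complex.I * ((φ2 - δ : ℝ) : ℂ))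
        - (a : ℂ) * Complex.exp (Complex.I * ((φ2 : ℝ) : ℂ))
      = a * (Complex.exp (Complex.I * (δ : ℂ)) - Complex.exp (Complex.I * ((0 : ℝ) : ℂ)))
        * (Complex.exp (Complex.I * (φ1 : ℂ))
          - Complex.exp (Complex.I * ((φ2 - δ : ℝ) : ℂ))) := by
    have h1 : Complex.exp (Complex.I * ((φ1 + δ : ℝ) : ℂ))
        = Complex.exp (Complex.I * (δ : ℂ)) * Complex.exp (Complex.I * (φ1 : ℂ)) := by
      rw [← Complex.exp_add]
      push_cast
      ring_nf
    have h2 : Complex.exp (Complex.I * (φ2 : ℂ))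
        = Complex.exp (Complex.I * (δ : ℂ)) * Complex.exp (Complex.I * ((φ2 - δ : ℝ) : ℂ)) := by
      rw [← Complex.exp_add]
      push_cast
      ring_nf
    rw [h1, h2, Complex.ofReal_zero, mul_zero, Complex.exp_zero]
    ring
  have hhalf : 1 - Real.cos δ = 2 * Real.sin (δ / 2) ^ 2 := by
    rw [Real.sin_sq_eq_half_sub, mul_div_cancel₀ δ two_ne_zero]
    ring
  rw [hfactor, norm_mul, norm_mul, mul_pow, mul_pow, norm_exp_I_mul_sub_exp_I_mul_sq,
    norm_exp_I_mul_sub_exp_I_mul_sq, Complex.norm_real, Real.norm_eq_abs, sq_abs, sub_zero, hhalf,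
    ← sub_add]
  ring
end

section
/- Let r ≥ 1 and V ≥ 1 be integers and let a > 0 and t ≥ 0 be real numbers, and consider the constellation C = { (a+vt)·e^{i·2πl/2^r} : 0 ≤ v ≤ V, 0 ≤ l ≤ 2^r−1 }. Define d_min(C) as the minimum of |c − c'| over distinct points c ≠ c' of C. Then: (i) if 0 < t < 2a·sin(π/2^r), then d_min(C) = t; (ii) if t ≥ 2a·sin(π/2^r) or t = 0, then d_min(C) = 2a·sin(π/2^r). (Constellation minimum-distance formula underlying Eq. (24) for the codeword MED d_min^x, which equals √2 times this quantity) -/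
/-- Law of cosines for two points in polar form, in half-angle shape. -/
lemma norm_polar_sub_polar_sq (ρ σ α β : ℝ) :
    ‖(ρ : ℂ) * Complex.exp (Complex.I * (α : ℂ)) - (σ : ℂ) * Complex.exp (Complex.I * (β : ℂ))‖ ^ 2
      = (ρ - σ) ^ 2 + 4 * (ρ * σ) * Real.sin ((α - β) / 2) ^ 2 := by
  have hhalf : Real.sin ((α - β) / 2) ^ 2 = 1 / 2 - Real.cos (α - β) / 2 := by
    rw [Real.sin_sq_eq_half_sub]
    ring_nf
  rw [hhalf, Real.cos_sub, ← Complex.normSq_eq_norm_sq, Complex.normSq_apply,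
    mul_comm Complex.I, mul_comm Complex.I, Complex.exp_mul_I, Complex.exp_mul_I,
    ← Complex.ofReal_cos, ← Complex.ofReal_sin, ← Complex.ofReal_cos, ← Complex.ofReal_sin]
  simp only [Complex.sub_re, Complex.sub_im, Complex.mul_re, Complex.mul_im, Complex.add_re,
    Complex.add_im, Complex.ofReal_re, Complex.ofReal_im, Complex.I_re, Complex.I_im]
  linear_combination ρ ^ 2 * Real.sin_sq_add_cos_sq α + σ ^ 2 * Real.sin_sq_add_cos_sq β

lemma sin_le_sin_of_le_of_le_pi_sub {x y : ℝ} (hx : 0 ≤ x) (hxy : x ≤ y)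
    (hy : y ≤ Real.pi - x) : Real.sin x ≤ Real.sin y := by
  rcases le_total y (Real.pi / 2) with h | h
  · exact Real.sin_le_sin_of_le_of_le_pi_div_two (by linarith [Real.pi_pos]) h hxy
  · rw [← Real.sin_pi_sub y]
    exact Real.sin_le_sin_of_le_of_le_pi_div_two (by linarith [Real.pi_pos])
      (by linarith) (by linarith)

lemma sin_pi_div_le_sin_mul {N k : ℕ} (hk : 1 ≤ k) (hkN : k < N) :
    Real.sin (Real.pi / N) ≤ Real.sin (Real.pi * k / N) := by
  have hN : (0 : ℝ) < N := by exact_mod_cast (by lia : 0 < N)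
  have hk' : (1 : ℝ) ≤ k := by exact_mod_cast hk
  have hkN' : (k : ℝ) + 1 ≤ N := by exact_mod_cast hkN
  have hpi := Real.pi_pos
  apply sin_le_sin_of_le_of_le_pi_sub (by positivity)
  · gcongr
    nlinarith
  · rw [le_sub_iff_add_le, ← add_div, div_le_iff₀ hN]
    nlinarith

lemma sin_pi_div_sq_le {N l m : ℕ} (hl : l < N) (hm : m < N) (hlm : l ≠ m) :
    Real.sin (Real.pi / N) ^ 2 ≤ Real.sin (Real.pi * ((l : ℝ) - m) / N) ^ 2 := by
  wlog h : m < l generalizing l m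
  · have := this hm hl hlm.symm (by lia)
    rwa [← neg_sub (l : ℝ), mul_neg, neg_div, Real.sin_neg, neg_sq] at this
  have h0 : 0 ≤ Real.sin (Real.pi / N) :=
    Real.sin_nonneg_of_nonneg_of_le_pi (by positivity)
      (div_le_self Real.pi_pos.le (by exact_mod_cast (by lia : 1 ≤ N)))
  have := sin_pi_div_le_sin_mul (N := N) (k := l - m) (by lia) (by lia)
  rw [Nat.cast_sub h.le] at this
  gcongr

/-- Distinct points of a ring constellation are at distance at least `2 a sin (π / N)` if their
phases differ, and at least the ring spacing `t`, which is then nonzero, otherwise. -/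
lemma ring_constellation_dist_lower_bound {N l m : ℕ} (hl : l < N) (hm : m < N) (v w : ℕ)
    {a t : ℝ} (ha : 0 < a) (ht : 0 ≤ t) {c c' : ℂ} (hne : c ≠ c')
    (hc : c = ((a + (v : ℝ) * t : ℝ) : ℂ) *
      Complex.exp (Complex.I * ((2 * Real.pi * (l : ℝ) / N : ℝ) : ℂ)))
    (hc' : c' = ((a + (w : ℝ) * t : ℝ) : ℂ) *
      Complex.exp (Complex.I * ((2 * Real.pi * (m : ℝ) / N : ℝ) : ℂ))) :
    2 * a * Real.sin (Real.pi / N) ≤ ‖c - c'‖ ∨ (t ≠ 0 ∧ t ≤ ‖c - c'‖) := by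
  have hsq := norm_polar_sub_polar_sq (a + v * t) (a + w * t) (2 * Real.pi * l / N)
    (2 * Real.pi * m / N)
  rw [← hc, ← hc'] at hsq
  have hangle : (2 * Real.pi * l / N - 2 * Real.pi * m / N) / 2
      = Real.pi * ((l : ℝ) - m) / N := by ring
  rw [hangle] at hsq
  by_cases hlm : l = m
  · right
    subst hlm
    have hvw : v ≠ w := by
      rintro rfl
      exact hne (hc.trans hc'.symm)
    have ht0 : t ≠ 0 := by
      rintro rfl
      exact hne (by rw [hc, hc']; simp)
    refine ⟨ht0, le_of_pow_le_pow_left₀ two_ne_zero (norm_nonneg _) ?_⟩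
    have hint : (1 : ℝ) ≤ ((v : ℝ) - w) ^ 2 := by
      have : (1 : ℤ) ≤ ((v : ℤ) - w) ^ 2 := by
        have : (v : ℤ) - w ≠ 0 := by lia
        have : 0 < ((v : ℤ) - w) ^ 2 := by positivity
        lia
      exact_mod_cast this
    rw [hsq, sub_self, mul_zero, zero_div, Real.sin_zero]
    nlinarith [sq_nonneg t]
  · left
    refine le_of_pow_le_pow_left₀ two_ne_zero (norm_nonneg _) ?_
    have hsin := sin_pi_div_sq_le hl hm hlm
    have hv : 0 ≤ (v : ℝ) * t := by positivity
    have hw : 0 ≤ (w : ℝ) * t := by positivity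
    have hprod : a * a ≤ (a + v * t) * (a + w * t) := by gcongr <;> linarith
    calc (2 * a * Real.sin (Real.pi / N)) ^ 2
        = 4 * (a * a) * Real.sin (Real.pi / N) ^ 2 := by ring
      _ ≤ 4 * ((a + v * t) * (a + w * t)) * Real.sin (Real.pi * ((l : ℝ) - m) / N) ^ 2 := by
          gcongr
      _ ≤ ‖c - c'‖ ^ 2 := by
          rw [hsq]
          exact le_add_of_nonneg_left (sq_nonneg _)

/-- **Minimum-distance formula underlying Eq. (24).** For the constellation of `V+1`
concentric rings of radii `a, a+t, …, a+Vt`, each carrying `2^r` equally spaced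
phases: (i) if `0 < t < 2a·sin(π/2^r)` the minimum distance between distinct points
is `t`; (ii) if `t ≥ 2a·sin(π/2^r)` or `t = 0` it is `2a·sin(π/2^r)`. -/
theorem ring_constellation_min_distance
    (r V : ℕ) (hr : 1 ≤ r) (hV : 1 ≤ V)
    (a t : ℝ) (ha : 0 < a) (ht : 0 ≤ t)
    (C : Set ℂ)
    (hC : C = {z : ℂ | ∃ v : Fin (V + 1), ∃ l : Fin (2 ^ r),
      z = ((a + ((v : ℕ) : ℝ) * t : ℝ) : ℂ) *
        Complex.exp (Complex.I * ((2 * Real.pi * ((l : ℕ) : ℝ) / 2 ^ r : ℝ) : ℂ))}) :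
    (0 < t ∧ t < 2 * a * Real.sin (Real.pi / 2 ^ r) →
      IsLeast {d : ℝ | ∃ c ∈ C, ∃ c' ∈ C, c ≠ c' ∧ d = ‖c - c'‖} t) ∧
    (2 * a * Real.sin (Real.pi / 2 ^ r) ≤ t ∨ t = 0 →
      IsLeast {d : ℝ | ∃ c ∈ C, ∃ c' ∈ C, c ≠ c' ∧ d = ‖c - c'‖}
        (2 * a * Real.sin (Real.pi / 2 ^ r))) := by
  have hpow : 1 < 2 ^ r := Nat.one_lt_two_pow (by lia)
  have hs : 0 < Real.sin (Real.pi / 2 ^ r) := by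
    apply Real.sin_pos_of_pos_of_lt_pi (by positivity)
    exact div_lt_self Real.pi_pos (by exact_mod_cast hpow)
  have hlower : ∀ c ∈ C, ∀ c' ∈ C, c ≠ c' →
      2 * a * Real.sin (Real.pi / 2 ^ r) ≤ ‖c - c'‖ ∨ (t ≠ 0 ∧ t ≤ ‖c - c'‖) := by
    subst hC
    rintro c ⟨v, l, hc⟩ c' ⟨w, m, hc'⟩ hne
    have := ring_constellation_dist_lower_bound l.2 m.2 v w ha ht hne
      (by simpa using hc) (by simpa using hc')
    simpa using this
  have hbase : (a : ℂ) ∈ C := by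
    rw [hC]
    exact ⟨0, ⟨0, by lia⟩, by simp⟩
  constructor
  · rintro ⟨ht0, hlt⟩
    constructor
    · have hnext : ((a + t : ℝ) : ℂ) ∈ C := by
        rw [hC]
        exact ⟨⟨1, by lia⟩, ⟨0, by lia⟩, by simp⟩
      refine ⟨_, hnext, _, hbase, ?_, ?_⟩
      · exact_mod_cast (by linarith : a + t ≠ a)
      · rw [← Complex.ofReal_sub, Complex.norm_real, add_sub_cancel_left, Real.norm_of_nonneg ht]
    · rintro d ⟨c, hc, c', hc', hne, rfl⟩
      rcases hlower c hc c' hc' hne with h | h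
      · exact hlt.le.trans h
      · exact h.2
  · intro hcase
    constructor
    · have hnext : (a : ℂ) * Complex.exp (Complex.I * ((2 * Real.pi / 2 ^ r : ℝ) : ℂ)) ∈ C := by
        rw [hC]
        exact ⟨0, ⟨1, hpow⟩, by simp⟩
      have hnorm : 2 * a * Real.sin (Real.pi / 2 ^ r)
          = ‖(a : ℂ) * Complex.exp (Complex.I * ((2 * Real.pi / 2 ^ r : ℝ) : ℂ)) - a‖ := by
        have hsq := norm_polar_sub_polar_sq a a (2 * Real.pi / 2 ^ r) 0
        rw [Complex.ofReal_zero, mul_zero, Complex.exp_zero, mul_one,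
          show (2 * Real.pi / 2 ^ r - 0) / 2 = Real.pi / 2 ^ r by ring] at hsq
        refine (sq_eq_sq₀ (by positivity) (norm_nonneg _)).mp ?_
        rw [hsq]
        ring
      refine ⟨_, hnext, _, hbase, ?_, hnorm⟩
      rw [← sub_ne_zero, ← norm_ne_zero_iff, ← hnorm]
      positivity
    · rintro d ⟨c, hc, c', hc', hne, rfl⟩
      rcases hlower c hc c' hc' hne with h | ⟨h0, h⟩
      · exact h
      · exact (hcase.resolve_right h0).trans h
end
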